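/- Let D = (V, A) be an acyclic digraph and let C be a convex set of vertices of D with C ≠ V. Then there exist distinct vertices c_1, c_2, …, c_t such that V = C ∪ {c_1, c_2, …, c_t} (a disjoint union) and, for every i ∈ {1, 2, …, t}, the vertex c_i is a source or a sink of the subdigraph of D induced by C ∪ {c_i, c_{i+1}, …, c_t}. -/

import Mathlib

variable {V : Type*}

/-- A digraph (given by its arc relation) is acyclic if it has no directed cycle. -/
def DigraphAcyclic (A : V → V → Prop) : Prop :=
  ∀ v : V, ¬ Relation.TransGen A v v

/-- `IsPathFromTo A u p w` states that `u :: (p ++ [w])` is a directed path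
from `u` to `w` in the digraph with arc relation `A`, whose internal vertices
are listed (in order) by `p`. -/
def IsPathFromTo (A : V → V → Prop) (u : V) (p : List V) (w : V) : Prop :=
  List.Chain A u (p ++ [w]) ∧ (u :: (p ++ [w])).Nodup

/-- A set `S` of vertices is convex if it is nonempty and no directed path between
vertices of `S` contains a vertex not in `S`. -/
def DigraphConvex (A : V → V → Prop) (S : Set V) : Prop :=
  S.Nonempty ∧ ∀ (u w : V) (p : List V), u ∈ S → w ∈ S → IsPathFromTo A u p w →
    ∀ x ∈ p, x ∈ S

/-- A set `S` of vertices is connected if it is nonempty and the underlying undirected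
graph of the subdigraph induced by `S` is connected. -/
def DigraphConnectedSet (A : V → V → Prop) (S : Set V) : Prop :=
  S.Nonempty ∧ ∀ x ∈ S, ∀ y ∈ S,
    Relation.ReflTransGen (fun a b => a ∈ S ∧ b ∈ S ∧ (A a b ∨ A b a)) x y

/-- A cc-set: a set that is both connected and convex. -/
def DigraphCC (A : V → V → Prop) (S : Set V) : Prop :=
  DigraphConnectedSet A S ∧ DigraphConvex A S

/-- A digraph is connected if its underlying undirected graph is connected. -/
def DigraphConnected (A : V → V → Prop) : Prop :=
  ∀ x y : V, Relation.ReflTransGen (fun a b => A a b ∨ A b a) x y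

/-- There is an `S`-path: a directed path with at least three vertices whose endpoints
are in `S` and whose internal vertices are not in `S`. -/
def HasSPath (A : V → V → Prop) (S : Set V) : Prop :=
  ∃ (u w : V) (p : List V), u ∈ S ∧ w ∈ S ∧ p ≠ [] ∧ (∀ x ∈ p, x ∉ S) ∧
    IsPathFromTo A u p w

/-- `s` is a source of the subdigraph induced by `S`. -/
def IsSourceIn (A : V → V → Prop) (S : Set V) (s : V) : Prop :=
  ∀ y ∈ S, ¬ A y s

/-- `s` is a sink of the subdigraph induced by `S`. -/
def IsSinkIn (A : V → V → Prop) (S : Set V) (s : V) : Prop :=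
  ∀ y ∈ S, ¬ A s y

/-- A directed walk of positive length lists its internal vertices. -/
theorem exists_isChain_of_transGen {V : Type*} {A : V → V → Prop} {u w : V}
    (h : Relation.TransGen A u w) : ∃ p : List V, List.IsChain A (u :: (p ++ [w])) := by
  induction h using Relation.TransGen.head_induction_on with
  | single h => exact ⟨[], by simpa using h⟩
  | head h _ ih =>
    obtain ⟨p, hp⟩ := ih
    exact ⟨_ :: p, by simpa using ⟨h, hp⟩⟩

/-- In an acyclic digraph the vertices of a directed walk are distinct. -/
theorem DigraphAcyclic.nodup_of_isChain {V : Type*} {A : V → V → Prop}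
    (hA : DigraphAcyclic A) {l : List V} (h : List.IsChain A l) : l.Nodup := by
  have h' : List.IsChain (Relation.TransGen A) l := h.imp fun _ _ => Relation.TransGen.single
  refine h'.pairwise.imp ?_
  rintro a _ hab rfl
  exact hA a hab

/-- A vertex that is reachable from a convex set and reaches it lies in it. -/
theorem DigraphConvex.mem_of_transGen {V : Type*} {A : V → V → Prop} {C : Set V}
    (hC : DigraphConvex A C) (hA : DigraphAcyclic A) {u x w : V} (hu : u ∈ C) (hw : w ∈ C)
    (hux : Relation.TransGen A u x) (hxw : Relation.TransGen A x w) : x ∈ C := by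
  obtain ⟨p, hp⟩ := exists_isChain_of_transGen hux
  obtain ⟨q, hq⟩ := exists_isChain_of_transGen hxw
  have h : List.IsChain A (u :: ((p ++ x :: q) ++ [w])) := by
    have := List.isChain_split (l₁ := u :: p) (l₂ := q ++ [w]) (c := x) (R := A) |>.2
      ⟨by simpa using hp, hq⟩
    simpa using this
  exact hC.2 u w (p ++ x :: q) hu hw ⟨h, hA.nodup_of_isChain h⟩ x (by simp)

/-- A nonempty set of vertices of a finite acyclic digraph induces a subdigraph with a source. -/
theorem DigraphAcyclic.exists_isSourceIn {V : Type*} [Finite V] {A : V → V → Prop}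
    (hA : DigraphAcyclic A) {S : Set V} (hS : S.Nonempty) : ∃ s ∈ S, IsSourceIn A S s := by
  have : Std.Irrefl (Relation.TransGen A) := ⟨hA⟩
  obtain ⟨s, hs, h⟩ :=
    (Finite.wellFounded_of_trans_of_irrefl (Relation.TransGen A)).has_min S hS
  exact ⟨s, hs, fun y hy hys => h y hy (.single hys)⟩

/-- A nonempty set of vertices of a finite acyclic digraph induces a subdigraph with a sink. -/
theorem DigraphAcyclic.exists_isSinkIn {V : Type*} [Finite V] {A : V → V → Prop}
    (hA : DigraphAcyclic A) {S : Set V} (hS : S.Nonempty) : ∃ s ∈ S, IsSinkIn A S s := by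
  have hA' : DigraphAcyclic (Function.swap A) := fun v h => hA v (Relation.transGen_swap.1 h)
  exact hA'.exists_isSourceIn hS

/-- If `S` is nonempty and disjoint from a convex set `C`, then some vertex of `S` is a source
or a sink of the subdigraph induced by `C ∪ S`. -/
theorem DigraphConvex.exists_isSourceIn_or_isSinkIn {V : Type*} [Finite V] {A : V → V → Prop}
    {C S : Set V} (hC : DigraphConvex A C) (hA : DigraphAcyclic A) (hS : S.Nonempty)
    (hCS : ∀ x ∈ S, x ∉ C) : ∃ s ∈ S, IsSourceIn A (C ∪ S) s ∨ IsSinkIn A (C ∪ S) s := by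
  by_cases hP : {x ∈ S | ∃ u ∈ C, Relation.TransGen A u x}.Nonempty
  · obtain ⟨s, ⟨hs, u, hu, hus⟩, hsink⟩ := hA.exists_isSinkIn hP
    refine ⟨s, hs, Or.inr ?_⟩
    rintro y (hy | hy) hsy
    · exact hCS s hs (hC.mem_of_transGen hA hu hy hus (.single hsy))
    · exact hsink y ⟨hy, u, hu, hus.tail hsy⟩ hsy
  · obtain ⟨s, hs, hsource⟩ := hA.exists_isSourceIn hS
    refine ⟨s, hs, Or.inl ?_⟩
    rintro y (hy | hy) hys
    · exact hP ⟨s, hs, y, hy, .single hys⟩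
    · exact hsource y hy hys

/-- Every finite set of vertices disjoint from a convex set `C` can be eliminated one vertex at
a time, each being a source or a sink of what remains together with `C`. -/
theorem DigraphConvex.exists_elimination_list {V : Type*} [Finite V] {A : V → V → Prop}
    {C : Set V} (hC : DigraphConvex A C) (hA : DigraphAcyclic A) (S : Finset V)
    (hCS : ∀ x ∈ S, x ∉ C) :
    ∃ l : List V, l.Nodup ∧ (∀ x, x ∈ l ↔ x ∈ S) ∧
      ∀ (i : ℕ) (hi : i < l.length),
        IsSourceIn A (C ∪ {x | x ∈ l.drop i}) (l.get ⟨i, hi⟩) ∨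
        IsSinkIn A (C ∪ {x | x ∈ l.drop i}) (l.get ⟨i, hi⟩) := by
  classical
  induction S using Finset.strongInduction with
  | H S ih =>
    rcases S.eq_empty_or_nonempty with rfl | hS
    · exact ⟨[], by simp⟩
    obtain ⟨s, hs, hsS⟩ := hC.exists_isSourceIn_or_isSinkIn hA (S := (S : Set V)) hS hCS
    obtain ⟨l, hnd, hl, hord⟩ := ih (S.erase s) (Finset.erase_ssubset hs)
      fun x hx => hCS x (Finset.mem_of_mem_erase hx)
    have hmem : ∀ x, x ∈ s :: l ↔ x ∈ S := by
      intro x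
      rw [List.mem_cons, hl, Finset.mem_erase]
      by_cases hx : x = s
      · subst hx; simpa using hs
      · simp [hx]
    refine ⟨s :: l, List.nodup_cons.2 ⟨by simp [hl], hnd⟩, hmem, ?_⟩
    rintro (_ | i) hi
    · have : {x | x ∈ (s :: l).drop 0} = (S : Set V) := Set.ext hmem
      rw [this]
      exact hsS
    · exact hord i (Nat.lt_of_succ_lt_succ hi)

/-- If C is a convex set of an acyclic digraph D = (V, A) with C ≠ V,
then the vertices outside C can be listed as c_1, …, c_t so that each c_i is a source
or a sink of the subdigraph induced by C ∪ {c_i, c_{i+1}, …, c_t}. -/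
theorem exists_elimination_ordering {V : Type*} [Fintype V] (A : V → V → Prop)
    (C : Set V) (hA : DigraphAcyclic A) (hC : DigraphConvex A C)
    (hCV : C ≠ Set.univ) :
    ∃ l : List V, l.Nodup ∧ (∀ x ∈ l, x ∉ C) ∧ C ∪ {x | x ∈ l} = Set.univ ∧
      ∀ (i : ℕ) (hi : i < l.length),
        IsSourceIn A (C ∪ {x | x ∈ l.drop i}) (l.get ⟨i, hi⟩) ∨
        IsSinkIn A (C ∪ {x | x ∈ l.drop i}) (l.get ⟨i, hi⟩) := by
  classical
  obtain ⟨l, hnd, hl, hord⟩ := hC.exists_elimination_list hA (Finset.univ.filter (· ∉ C)) (by simp)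
  refine ⟨l, hnd, fun x hx => by simpa using (hl x).1 hx, ?_, hord⟩
  ext x
  simp [hl, em]
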